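/- Let F be a field of characteristic different from two, and let p and q be forms over F. If q becomes hyperbolic over the function field F(p), then H_K(p) ⊆ G_K(q) for every field extension K/F; that is, for every extension K/F and every a ∈ K× such that ⟨1,−a⟩ ⊗ p_K is isotropic over K, a is a similarity factor of q_K. -/

import Mathlib

set_option synthInstance.maxHeartbeats 1000000
set_option maxHeartbeats 4000000

open scoped BigOperators Classical

namespace QF

section Defs

variable {R : Type*} [CommRing R]

/-- Evaluation of the diagonal quadratic form with coefficients `d` at the vector `v`. -/
def evalQF {n : ℕ} (d : Fin n → R) (v : Fin n → R) : R := ∑ i, d i * v i ^ 2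

/-- A form is isotropic if it represents zero non-trivially. -/
def Isotropic {n : ℕ} (d : Fin n → R) : Prop := ∃ v : Fin n → R, v ≠ 0 ∧ evalQF d v = 0

def Anisotropic {n : ℕ} (d : Fin n → R) : Prop := ¬ Isotropic d

/-- Nondegeneracy of a diagonal form: all coefficients are nonzero. -/
def Nondeg {n : ℕ} (d : Fin n → R) : Prop := ∀ i, d i ≠ 0

/-- Two diagonal forms are isometric if a linear equivalence matches their values. -/
def Isometric {m n : ℕ} (d : Fin m → R) (e : Fin n → R) : Prop :=
  ∃ φ : (Fin m → R) ≃ₗ[R] (Fin n → R), ∀ v, evalQF e (φ v) = evalQF d v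

/-- Orthogonal sum of diagonal forms. -/
def osum {m n : ℕ} (d : Fin m → R) (e : Fin n → R) : Fin (m + n) → R := Fin.append d e

/-- Tensor product of diagonal forms. -/
def tensorQF {m n : ℕ} (d : Fin m → R) (e : Fin n → R) : Fin (m * n) → R :=
  fun i => d (finProdFinEquiv.symm i).1 * e (finProdFinEquiv.symm i).2

/-- Scaling of a form by a scalar. -/
def smulQF {n : ℕ} (a : R) (d : Fin n → R) : Fin n → R := fun i => a * d i

/-- `k` copies of the hyperbolic plane `⟨1,-1⟩`. -/
def hypform {R : Type*} [CommRing R] (k : ℕ) : Fin (k + k) → R :=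
  Fin.append (fun _ => 1) (fun _ => -1)

/-- A form is hyperbolic if it is isometric to a sum of hyperbolic planes,
i.e. its Witt index is half its dimension. -/
def IsHyperbolic {n : ℕ} (d : Fin n → R) : Prop := ∃ k : ℕ, Isometric d (hypform k)

/-- The Witt index: the largest `k` such that `d ≅ k×⟨1,-1⟩ ⊥ r`. -/
noncomputable def WittIndex {n : ℕ} (d : Fin n → R) : ℕ :=
  sSup {k : ℕ | ∃ (m : ℕ) (r : Fin m → R), Isometric d (osum (hypform k) r)}

/-- `r` is a subform of `d`: `d ≅ r ⊥ s` for some (nondegenerate) form `s`. -/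
def Subform {m n : ℕ} (r : Fin m → R) (d : Fin n → R) : Prop :=
  ∃ (k : ℕ) (s : Fin k → R), Nondeg s ∧ Isometric d (osum r s)

/-- The set of nonzero represented values. -/
def Dset {n : ℕ} (d : Fin n → R) : Set R :=
  {a | a ≠ 0 ∧ ∃ v : Fin n → R, evalQF d v = a}

/-- The group of similarity factors `G(q) = {a : a·q ≅ q}`. -/
def Gset {n : ℕ} (d : Fin n → R) : Set R :=
  {a | a ≠ 0 ∧ Isometric (smulQF a d) d}

/-- `H(q) = {a : ⟨1,-a⟩ ⊗ q is isotropic}`. -/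
def Hset {n : ℕ} (d : Fin n → R) : Set R :=
  {a | a ≠ 0 ∧ Isotropic (tensorQF ![1, -a] d)}

/-- Base change of a form along a ring homomorphism (e.g. a field extension). -/
def bc {S : Type*} [CommRing S] (f : R →+* S) {n : ℕ} (d : Fin n → R) : Fin n → S :=
  fun i => f (d i)

/-- The Pfister form `⟨1,a 0⟩ ⊗ ⋯ ⊗ ⟨1, a (n-1)⟩`: its `2^n` diagonal coefficients are
the products `∏_{j ∈ S} a j` over subsets `S` of the index set. -/
noncomputable def pfisterOf {n : ℕ} (a : Fin n → R) : Fin (2 ^ n) → R :=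
  fun i => ∏ j : Fin n, if (finFunctionFinEquiv.symm i) j = 0 then 1 else a j

/-- `π` is an `n`-fold Pfister form. -/
def IsNPfister (n : ℕ) {m : ℕ} (π : Fin m → R) : Prop :=
  ∃ a : Fin n → R, (∀ i, a i ≠ 0) ∧ Isometric π (pfisterOf a)

/-- `π` is a Pfister form. -/
def IsPfister {m : ℕ} (π : Fin m → R) : Prop := ∃ n : ℕ, IsNPfister n π

end Defs

/-- The quadric polynomial `p(X₁,…,Xₙ) = ∑ dᵢ Xᵢ²` attached to a diagonal form. -/
noncomputable def formPoly {F : Type*} [CommRing F] {n : ℕ} (d : Fin n → F) :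
    MvPolynomial (Fin n) F :=
  ∑ i, MvPolynomial.C (d i) * MvPolynomial.X i ^ 2

/-- The affine coordinate ring `F[X₁,…,Xₙ]/(p(X))` of the quadric `p = 0`. -/
abbrev CoordRing {F : Type*} [CommRing F] {n : ℕ} (d : Fin n → F) : Type _ :=
  MvPolynomial (Fin n) F ⧸ Ideal.span {formPoly d}

/-- The function field `F(p)` of the quadric `p = 0`: the total fraction ring of the
coordinate ring (the quotient field when the coordinate ring is a domain, i.e. when `p` is
anisotropic of dimension at least 2). -/
abbrev FunField {F : Type*} [Field F] {n : ℕ} (d : Fin n → F) : Type _ :=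
  FractionRing (CoordRing d)

end QF

namespace QF

open Module
open LinearMap (BilinForm)
open scoped Polynomial

section Similitudes

variable {K V : Type*} [Field K] [AddCommGroup V] [Module K V] [FiniteDimensional K V]

/-- A totally isotropic subspace `I` lies in a nondegenerate subspace `U` with
`U ∩ Iᗮ = I`, equipped with a projection `T` whose range is totally isotropic and which is
the identity modulo `I`. -/
theorem exists_metabolic_hull (h2 : (2 : K) ≠ 0) (B : BilinForm K V) (hB : B.Nondegenerate)
    (hs : ∀ x y, B x y = B y x) (I : Submodule K V) (hI : ∀ x ∈ I, ∀ y ∈ I, B x y = 0) :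
    ∃ (U : Submodule K V) (T : V →ₗ[K] V), I ≤ U ∧ IsCompl U (B.orthogonal U) ∧
      (∀ u ∈ U, u ∈ B.orthogonal I → u ∈ I) ∧ (∀ u ∈ U, T u ∈ U) ∧
      (∀ u v, B (T u) (T v) = 0) ∧ ∀ u ∈ U, u - T u ∈ I := by
  have hrefl : B.IsRefl := fun x y h => by rw [hs, h]
  have hII : I ≤ B.orthogonal I := fun x hx y hy => hI y hy x hx
  obtain ⟨C, hC⟩ := (B.orthogonal I).exists_isCompl
  have hker : ∀ i ∈ I, (∀ c ∈ C, B i c = 0) → i = 0 := by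
    intro i hi h
    refine hB.1 i fun y => ?_
    obtain ⟨a, ha, c, hc, rfl⟩ := Submodule.mem_sup.1 (hC.sup_eq_top ▸ Submodule.mem_top (x := y))
    rw [map_add, h c hc, ha i hi, add_zero]
  have hCI : ∀ u ∈ I ⊔ C, u ∈ B.orthogonal I → u ∈ I := by
    intro u hu hu'
    obtain ⟨i, hi, c, hc, rfl⟩ := Submodule.mem_sup.1 hu
    have : c ∈ B.orthogonal I := by simpa using Submodule.sub_mem _ hu' (hII hi)
    rw [Submodule.disjoint_def.1 hC.disjoint c this hc, add_zero]
    exact hi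
  let pairing : I →ₗ[K] Dual K C := (B.domRestrict I).compr₂ (LinearMap.id) |>.compl₂ C.subtype
  have hpair : ∀ (i : I) (c : C), pairing i c = B i c := fun i c => rfl
  have hinj : Function.Injective pairing := by
    rw [injective_iff_map_eq_zero]
    intro i hi
    refine Subtype.ext (hker i i.2 fun c hc => ?_)
    simpa [hpair] using LinearMap.congr_fun hi ⟨c, hc⟩
  have hdim : finrank K I = finrank K (Dual K C) := by
    have h1 := LinearMap.BilinForm.finrank_orthogonal hB I
    have h3 := Submodule.finrank_add_eq_of_isCompl hC
    have h4 := Submodule.finrank_le I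
    rw [Subspace.dual_finrank_eq]
    omega
  let e : I ≃ₗ[K] Dual K C := LinearEquiv.ofInjectiveOfFinrankEq pairing hinj hdim
  let h : C →ₗ[K] I := e.symm.toLinearMap ∘ₗ
    ((2⁻¹ : K) • ((B.domRestrict C).compl₂ C.subtype))
  have hh : ∀ c c' : C, B (h c) c' = 2⁻¹ * B c c' := by
    intro c c'
    have : pairing (h c) = e (h c) := rfl
    rw [← hpair, this]
    simp [h]
  let P : V →ₗ[K] C := Submodule.projectionOnto C _ hC.symm
  let T : V →ₗ[K] V := (C.subtype - I.subtype ∘ₗ h) ∘ₗ P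
  have hT : ∀ v, T v = P v - h (P v) := fun v => rfl
  refine ⟨I ⊔ C, T, le_sup_left, ?_, hCI, ?_, ?_, ?_⟩
  · rw [LinearMap.BilinForm.isCompl_orthogonal_iff_disjoint hrefl, Submodule.disjoint_def]
    intro u hu hu'
    refine hker u (hCI u hu fun i hi => hu' i (Submodule.mem_sup_left hi)) fun c hc => ?_
    rw [hs]
    exact hu' c (Submodule.mem_sup_right hc)
  · intro u _
    rw [hT]
    exact Submodule.sub_mem _ (Submodule.mem_sup_right (P u).2) (Submodule.mem_sup_left (h (P u)).2)
  · intro u v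
    rw [hT, hT]
    simp only [map_sub, LinearMap.sub_apply]
    rw [hh, hs (P u : V) (h (P v)), hh, hI _ (h (P u)).2 _ (h (P v)).2, hs (P v : V) (P u)]
    field_simp
    ring
  · intro u hu
    obtain ⟨i, hi, c, hc, rfl⟩ := Submodule.mem_sup.1 hu
    have hP : P (i + c) = ⟨c, hc⟩ := by
      rw [map_add]
      have h1 : P i = 0 := Submodule.projectionOnto_apply_right hC.symm ⟨i, hII hi⟩
      have h2 : P c = ⟨c, hc⟩ := Submodule.projectionOnto_apply_left hC.symm ⟨c, hc⟩
      rw [h1, h2, zero_add]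
    rw [hT, hP]
    have : i + c - (c - (h ⟨c, hc⟩ : V)) = i + h ⟨c, hc⟩ := by abel
    rw [this]
    exact Submodule.add_mem _ hi (h _).2

/-- Let `W ⊆ V × V` be stable under `(x, y) ↦ (Δ y, x)`, i.e. a subspace of the scalar extension
of `V` to `K(√Δ)`. If `W` is totally isotropic of at least half the dimension, every norm from
`K(√Δ)` is a similarity factor of `V`. -/
theorem exists_similitude_of_lagrangian (h2 : (2 : K) ≠ 0) (B : BilinForm K V)
    (hB : B.Nondegenerate) (hs : ∀ x y, B x y = B y x) {Δ : K} (hΔ : Δ ≠ 0)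
    (W : Submodule K (V × V)) (hj : ∀ x y, (x, y) ∈ W → (Δ • y, x) ∈ W)
    (hW : ∀ x y x' y', (x, y) ∈ W → (x', y') ∈ W → B x x' + Δ * B y y' = 0)
    (hdim : finrank K V ≤ finrank K W) (α β : K) :
    ∃ f : V →ₗ[K] V, ∀ x y, B (f x) (f y) = (α ^ 2 - Δ * β ^ 2) * B x y := by
  have hW' : ∀ x y x' y', (x, y) ∈ W → (x', y') ∈ W → B x y' + B y x' = 0 := by
    intro x y x' y' h h'
    have := hW _ _ _ _ h (hj _ _ h')
    rw [map_smul, smul_eq_mul, ← mul_add] at this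
    exact (mul_eq_zero.1 this).resolve_left hΔ
  let I : Submodule K V := W.comap (LinearMap.inl K V V)
  have memI : ∀ x, x ∈ I ↔ (x, 0) ∈ W := fun x => Iff.rfl
  have hI : ∀ x ∈ I, ∀ y ∈ I, B x y = 0 := by
    intro x hx y hy
    simpa using hW _ _ _ _ hx hy
  let Y : Submodule K V := W.map (LinearMap.snd K V V)
  have hY : Y = B.orthogonal I := by
    refine Submodule.eq_of_le_of_finrank_le ?_ ?_
    · rintro _ ⟨⟨x, y⟩, hxy, rfl⟩ i hi
      simpa using hW' _ _ _ _ hi hxy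
    · have h1 := LinearMap.BilinForm.finrank_orthogonal hB I
      have h3 := LinearMap.finrank_range_add_finrank_ker ((LinearMap.snd K V V).domRestrict W)
      have h4 : LinearMap.range ((LinearMap.snd K V V).domRestrict W) = Y := by
        rw [LinearMap.range_domRestrict]
      have h5 : finrank K (LinearMap.ker ((LinearMap.snd K V V).domRestrict W)) ≤ finrank K I := by
        let g : LinearMap.ker ((LinearMap.snd K V V).domRestrict W) →ₗ[K] I :=
          LinearMap.codRestrict I
            (LinearMap.fst K V V ∘ₗ W.subtype ∘ₗ Submodule.subtype _) (by
              rintro ⟨⟨⟨x, y⟩, hxy⟩, h⟩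
              have : y = 0 := h
              subst this
              exact hxy)
        refine LinearMap.finrank_le_finrank_of_injective (f := g) ?_
        rintro ⟨⟨⟨x, y⟩, hxy⟩, h⟩ ⟨⟨⟨x', y'⟩, hxy'⟩, h'⟩ hg
        have hy : y = 0 := h
        have hy' : y' = 0 := h'
        have hx : x = x' := congrArg Subtype.val hg
        subst hy hy' hx
        rfl
      rw [h4] at h3
      omega
  obtain ⟨U, T, hIU, hU, hUI, hTU, hTT, hT⟩ := exists_metabolic_hull h2 B hB hs I hI
  let V₀ : Submodule K V := B.orthogonal U
  have hV₀I : V₀ ≤ B.orthogonal I := fun z hz i hi => hz i (hIU hi)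
  let W₀ : Submodule K (V × V) := W ⊓ V₀.prod V₀
  let S : W₀ →ₗ[K] V₀ := LinearMap.codRestrict V₀ (LinearMap.snd K V V ∘ₗ W₀.subtype)
    fun w => w.2.2.2
  have hS : Function.Bijective S := by
    constructor
    · rw [injective_iff_map_eq_zero]
      rintro ⟨⟨x, y⟩, hxy, hx, hy⟩ h
      have hy0 : y = 0 := congrArg Subtype.val h
      subst hy0
      have : x = 0 := Submodule.disjoint_def.1 hU.disjoint x (hIU hxy) hx
      subst this
      rfl
    · rintro ⟨z, hz⟩
      have hzY : z ∈ Y := hY ▸ hV₀I hz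
      obtain ⟨⟨x, z'⟩, hxz, rfl⟩ := hzY
      have hx : x ∈ B.orthogonal I := hY ▸ ⟨_, hj _ _ hxz, rfl⟩
      obtain ⟨u, hu, x₀, hx₀, rfl⟩ :=
        Submodule.mem_sup.1 (hU.sup_eq_top ▸ Submodule.mem_top (x := x))
      have huI : u ∈ I := by
        refine hUI u hu ?_
        simpa using Submodule.sub_mem _ hx (hV₀I hx₀)
      refine ⟨⟨(x₀, z'), ?_, hx₀, hz⟩, rfl⟩
      simpa using Submodule.sub_mem _ hxz ((memI u).1 huI)
  let e : W₀ ≃ₗ[K] V₀ := LinearEquiv.ofBijective S hS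
  let J : V₀ →ₗ[K] V := LinearMap.fst K V V ∘ₗ W₀.subtype ∘ₗ e.symm.toLinearMap
  have hJ : ∀ z : V₀, (J z, (z : V)) ∈ W ∧ J z ∈ V₀ := by
    intro z
    have h1 : ((e.symm z : W₀) : V × V) = (J z, (z : V)) := by
      refine Prod.ext rfl ?_
      exact congrArg Subtype.val (e.apply_symm_apply z)
    have h3 := (e.symm z).2
    rw [h1] at h3
    exact ⟨h3.1, h3.2.1⟩
  let PU : V →ₗ[K] U := Submodule.projectionOnto U V₀ hU
  let PV : V →ₗ[K] V₀ := Submodule.projectionOnto V₀ U hU.symm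
  have hdec : ∀ v, v = PU v + PV v := fun v =>
    (Submodule.projection_add_projection_eq_self hU v).symm
  let γ := α ^ 2 - Δ * β ^ 2
  let g : V →ₗ[K] V := γ • LinearMap.id + (1 - γ) • T
  let k : V₀ →ₗ[K] V := α • V₀.subtype + β • J
  have hg : ∀ u ∈ U, g u ∈ U := fun u hu =>
    Submodule.add_mem _ (Submodule.smul_mem _ _ hu) (Submodule.smul_mem _ _ (hTU u hu))
  have hk : ∀ z, k z ∈ V₀ := fun z =>
    Submodule.add_mem _ (Submodule.smul_mem _ _ z.2) (Submodule.smul_mem _ _ (hJ z).2)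
  have hgg : ∀ u ∈ U, ∀ v ∈ U, B (g u) (g v) = γ * B u v := by
    intro u hu v hv
    have h1 := hI _ (hT u hu) _ (hT v hv)
    have h3 := hTT u v
    simp only [map_sub, LinearMap.sub_apply] at h1
    simp only [g, LinearMap.add_apply, LinearMap.smul_apply, LinearMap.id_apply, map_add,
      map_smul, smul_eq_mul]
    linear_combination (-(γ * (1 - γ))) * h1 + (1 - γ) * h3
  have hkk : ∀ z w, B (k z) (k w) = γ * B z w := by
    intro z w
    have h1 := hW _ _ _ _ (hJ z).1 (hJ w).1
    have h3 := hW' _ _ _ _ (hJ z).1 (hJ w).1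
    simp only [k, LinearMap.add_apply, LinearMap.smul_apply, map_add, Submodule.subtype_apply,
      map_smul, smul_eq_mul, γ]
    linear_combination β ^ 2 * h1 + α * β * h3
  have h0 : ∀ u ∈ U, ∀ z ∈ V₀, B u z = 0 := fun u hu z hz => hz u hu
  refine ⟨g ∘ₗ U.subtype ∘ₗ PU + k ∘ₗ PV, fun x y => ?_⟩
  have e1 : B x y = B (PU x : V) (PU y : V) + B (PV x : V) (PV y : V) := by
    conv_lhs => rw [hdec x, hdec y]
    simp only [map_add, LinearMap.add_apply]
    rw [h0 _ (PU x).2 _ (PV y).2, hs (PV x : V) (PU y), h0 _ (PU y).2 _ (PV x).2]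
    ring
  rw [e1, mul_add, ← hgg _ (PU x).2 _ (PU y).2, ← hkk]
  simp only [map_add, LinearMap.add_apply, LinearMap.comp_apply, Submodule.subtype_apply]
  rw [h0 _ (hg _ (PU x).2) _ (hk (PV y)), hs (k (PV x)) (g (PU y)),
    h0 _ (hg _ (PU y).2) _ (hk (PV x))]
  ring

end Similitudes

/-- A diagonal form of dimension `n` has a totally isotropic subspace of dimension at least
`n / 2`. -/
def HasLagrangian {K : Type*} [Field K] {n : ℕ} (d : Fin n → K) : Prop :=
  ∃ W : Submodule K (Fin n → K),
    (∀ x ∈ W, ∀ y ∈ W, ∑ i, d i * x i * y i = 0) ∧ n ≤ 2 * finrank K W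

section Lagrangian

theorem evalQF_add {R : Type*} [CommRing R] {n : ℕ} (d x y : Fin n → R) :
    evalQF d (x + y) = evalQF d x + evalQF d y + 2 * ∑ i, d i * x i * y i := by
  simp only [evalQF, Finset.mul_sum, ← Finset.sum_add_distrib, Pi.add_apply]
  exact Finset.sum_congr rfl fun i _ => by ring

theorem evalQF_smul {R : Type*} [CommRing R] {n : ℕ} (d : Fin n → R) (c : R) (x : Fin n → R) :
    evalQF d (c • x) = c ^ 2 * evalQF d x := by
  simp only [evalQF, Finset.mul_sum, Pi.smul_apply, smul_eq_mul]
  exact Finset.sum_congr rfl fun i _ => by ring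

theorem evalQF_hypform_append_self {R : Type*} [CommRing R] {k : ℕ} (u : Fin k → R) :
    evalQF (hypform k) (Fin.append u u) = 0 := by
  simp [evalQF, hypform, Fin.sum_univ_add, -Fin.natAdd_eq_addNat]

/-- A hyperbolic form has a basis of a totally isotropic direct summand of half the rank. -/
theorem IsHyperbolic.exists_isotropic_frame {R : Type*} [CommRing R] [Nontrivial R]
    (h2 : IsUnit (2 : R)) {n : ℕ} {d : Fin n → R} (h : IsHyperbolic d) :
    ∃ (k : ℕ) (a b : Fin k → Fin n → R), n = k + k ∧
      (∀ i j, ∑ l, d l * a i l * a j l = 0) ∧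
      ∀ i j, ∑ l, b i l * a j l = if i = j then 1 else 0 := by
  obtain ⟨k, φ, hφ⟩ := h
  have hn : n = k + k := by
    have := φ.finrank_eq
    simpa using this
  let u : Fin k → Fin (k + k) → R := fun j => Fin.append (Pi.single j 1) (Pi.single j 1)
  have hu : ∀ v : Fin k → R, evalQF d (φ.symm (Fin.append v v)) = 0 := fun v => by
    rw [← hφ, φ.apply_symm_apply, evalQF_hypform_append_self]
  refine ⟨k, fun j => φ.symm (u j), fun i l => φ (Pi.single l 1) (Fin.castAdd k i), hn, ?_, ?_⟩
  · intro i j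
    have h1 := evalQF_add d (φ.symm (u i)) (φ.symm (u j))
    have h3 : u i + u j = Fin.append (Pi.single i 1 + Pi.single j 1 : Fin k → R)
        (Pi.single i 1 + Pi.single j 1) := by
      ext l
      refine Fin.addCases (fun l => ?_) (fun l => ?_) l <;> simp [u, -Fin.natAdd_eq_addNat]
    rw [← map_add, h3, hu, hu, hu, zero_add, zero_add] at h1
    exact h2.mul_right_eq_zero.1 h1.symm
  · intro i j
    have h1 := congrFun (LinearMap.pi_apply_eq_sum_univ φ.toLinearMap (φ.symm (u j)))
      (Fin.castAdd k i)
    simp only [LinearEquiv.coe_coe, φ.apply_symm_apply, Finset.sum_apply, Pi.smul_apply,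
      smul_eq_mul] at h1
    have h3 : u j (Fin.castAdd k i) = if i = j then 1 else 0 := by
      simp [u, Pi.single_apply]
    rw [← h3, h1]
    refine Finset.sum_congr rfl fun l _ => ?_
    rw [mul_comm]
    have h4 : (Pi.single l 1 : Fin n → R) = fun m => if l = m then 1 else 0 := by
      funext m
      simp [Pi.single_apply, eq_comm]
    rw [← h4]

/-- Hyperbolicity over the total fraction ring of `A` gives a Lagrangian at every point of
`Spec A` outside a suitable divisor. -/
theorem IsHyperbolic.exists_nonZeroDivisor_hasLagrangian {A : Type*} [CommRing A]
    [Nontrivial A] (h2 : IsUnit (2 : A)) {n : ℕ} {d : Fin n → A}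
    (h : IsHyperbolic (bc (algebraMap A (FractionRing A)) d)) :
    ∃ s ∈ nonZeroDivisors A, ∀ {E : Type*} [Field E] (ψ : A →+* E), ψ s ≠ 0 →
      HasLagrangian (bc ψ d) := by
  have h2' : IsUnit (2 : FractionRing A) := by
    simpa only [map_ofNat] using h2.map (algebraMap A (FractionRing A))
  obtain ⟨k, a, b, hn, ha, hb⟩ := h.exists_isotropic_frame h2'
  obtain ⟨s, hs⟩ := IsLocalization.exist_integer_multiples_of_finite (nonZeroDivisors A)
    (fun x : (Fin k × Fin n) ⊕ (Fin k × Fin n) =>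
      (Sum.elim (fun x => a x.1 x.2) (fun x => b x.1 x.2) x : FractionRing A))
  choose a' ha' using fun i l => hs (Sum.inl (i, l))
  choose b' hb' using fun i l => hs (Sum.inr (i, l))
  simp only [Sum.elim_inl, Sum.elim_inr, Algebra.smul_def] at ha' hb'
  have hinj := IsFractionRing.injective A (FractionRing A)
  have h1 : ∀ i j, ∑ l, d l * a' i l * a' j l = 0 := by
    intro i j
    apply hinj
    rw [map_sum, map_zero, ← mul_zero (algebraMap A (FractionRing A) (s * s)), ← ha i j,
      Finset.mul_sum]
    refine Finset.sum_congr rfl fun l _ => ?_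
    simp only [map_mul, ha', bc]
    ring
  have h3 : ∀ i j, ∑ l, b' i l * a' j l = if i = j then (s * s : A) else 0 := by
    intro i j
    apply hinj
    have : algebraMap A (FractionRing A) (if i = j then (s * s : A) else 0) =
        algebraMap A (FractionRing A) (s * s) * if i = j then 1 else 0 := by
      split_ifs <;> simp
    rw [map_sum, this, ← hb i j, Finset.mul_sum]
    refine Finset.sum_congr rfl fun l _ => ?_
    simp only [map_mul, ha', hb']
    ring
  refine ⟨s, s.2, fun {E} _ ψ hψ => ?_⟩
  let c : Fin k → Fin n → E := fun i l => ψ (a' i l)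
  have hli : LinearIndependent E c := by
    rw [Fintype.linearIndependent_iff]
    intro g hg i
    have h4 : ∑ l, ψ (b' i l) * (∑ j, g j • c j) l = 0 := by
      rw [hg]
      simp
    simp only [Finset.sum_apply, Pi.smul_apply, smul_eq_mul, Finset.mul_sum] at h4
    rw [Finset.sum_comm] at h4
    have h5 : ∀ j, ∑ l, ψ (b' i l) * (g j * c j l) = if i = j then g j * ψ (s * s) else 0 := by
      intro j
      have := congrArg ψ (h3 i j)
      rw [map_sum] at this
      calc ∑ l, ψ (b' i l) * (g j * c j l) = g j * ∑ l, ψ (b' i l * a' j l) := by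
            rw [Finset.mul_sum]
            exact Finset.sum_congr rfl fun l _ => by rw [map_mul]; ring
        _ = _ := by rw [this]; split_ifs <;> simp
    simp only [h5, Finset.sum_ite_eq, Finset.mem_univ, if_true, map_mul] at h4
    simpa [hψ] using h4
  refine ⟨Submodule.span E (Set.range c), ?_, ?_⟩
  · intro x hx y hy
    rw [Submodule.mem_span_range_iff_exists_fun] at hx hy
    obtain ⟨f, rfl⟩ := hx
    obtain ⟨g, rfl⟩ := hy
    have h6 : ∀ i j, ∑ l, ψ (d l) * c i l * c j l = 0 := by
      intro i j
      simpa [c] using congrArg ψ (h1 i j)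
    calc ∑ l, bc ψ d l * (∑ i, f i • c i) l * (∑ j, g j • c j) l
        = ∑ l, ∑ i, ∑ j, f i * g j * (ψ (d l) * c i l * c j l) := by
          refine Finset.sum_congr rfl fun l _ => ?_
          simp only [Finset.sum_apply, Pi.smul_apply, smul_eq_mul, Finset.mul_sum,
            Finset.sum_mul, bc]
          rw [Finset.sum_comm]
          exact Finset.sum_congr rfl fun i _ => Finset.sum_congr rfl fun j _ => by ring
      _ = ∑ i, ∑ j, f i * g j * ∑ l, ψ (d l) * c i l * c j l := by
          rw [Finset.sum_comm]
          refine Finset.sum_congr rfl fun i _ => ?_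
          rw [Finset.sum_comm]
          exact Finset.sum_congr rfl fun j _ => by rw [Finset.mul_sum]
      _ = 0 := by simp [h6]
  · rw [finrank_span_eq_card hli, Fintype.card_fin]
    omega

/-- A Lagrangian over the rational function field specializes at `0`. -/
theorem HasLagrangian.of_rationalFunctions {L E : Type*} [Field L] [Field E]
    [Algebra L[X] E] [IsFractionRing L[X] E] {n : ℕ} {d : Fin n → L}
    (h : HasLagrangian (bc ((algebraMap L[X] E).comp Polynomial.C) d)) : HasLagrangian d := by
  obtain ⟨W, hW, hn⟩ := h
  let ι : (Fin n → L[X]) →ₗ[L[X]] (Fin n → E) := (Algebra.linearMap L[X] E).compLeft (Fin n)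
  have hι : ∀ x l, ι x l = algebraMap L[X] E (x l) := fun x l => rfl
  let M : Submodule L[X] (Fin n → L[X]) := (W.restrictScalars L[X]).comap ι
  have memM : ∀ x, x ∈ M ↔ ι x ∈ W := fun x => Iff.rfl
  obtain ⟨m, ⟨β⟩⟩ := M.nonempty_basis_of_pid (Pi.basisFun L[X] (Fin n))
  have hm : finrank E W ≤ m := by
    have hle : W ≤ Submodule.span E (Set.range fun i : Fin m => ι (β i)) := by
      intro w hw
      obtain ⟨s, hs⟩ := IsLocalization.exist_integer_multiples_of_finite (nonZeroDivisors L[X]) w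
      choose x hx using hs
      have hxw : ι x = algebraMap L[X] E s • w := by
        ext l
        rw [hι, hx, Pi.smul_apply, smul_eq_mul, Algebra.smul_def]
      have hxM : x ∈ M := by
        rw [memM, hxw]
        exact W.smul_mem _ hw
      have h0 : algebraMap L[X] E s ≠ 0 := IsFractionRing.to_map_ne_zero_of_mem_nonZeroDivisors s.2
      rw [← inv_smul_smul₀ h0 w, ← hxw]
      refine Submodule.smul_mem _ _ ?_
      have h1 := congrArg Subtype.val (β.sum_repr ⟨x, hxM⟩)
      simp only [Submodule.coe_sum, Submodule.coe_smul] at h1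
      rw [← h1, map_sum]
      refine Submodule.sum_mem _ fun i _ => ?_
      rw [map_smul, ← algebraMap_smul E]
      exact Submodule.smul_mem _ _ (Submodule.subset_span ⟨i, rfl⟩)
    refine (Submodule.finrank_mono hle).trans ?_
    exact (finrank_range_le_card (R := E) (fun i : Fin m => ι (β i))).trans (by simp)
  let c : Fin m → Fin n → L := fun i l => ((β i : Fin n → L[X]) l).eval 0
  have hli : LinearIndependent L c := by
    rw [Fintype.linearIndependent_iff]
    intro g hg i
    let x : M := ∑ j, Polynomial.C (g j) • β j
    have hx : ∀ l, Polynomial.X ∣ (x : Fin n → L[X]) l := by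
      intro l
      rw [Polynomial.X_dvd_iff, Polynomial.coeff_zero_eq_eval_zero]
      have := congrFun hg l
      simp only [Finset.sum_apply, Pi.smul_apply, smul_eq_mul, Pi.zero_apply] at this
      simp only [x, Submodule.coe_sum, Submodule.coe_smul, Finset.sum_apply, Pi.smul_apply,
        smul_eq_mul, Polynomial.eval_finsetSum, Polynomial.eval_mul, Polynomial.eval_C]
      exact this
    choose y hy using hx
    have hyM : y ∈ M := by
      have h1 : ι x = algebraMap L[X] E Polynomial.X • ι y := by
        ext l
        simp only [hι, hy, map_mul, Pi.smul_apply, smul_eq_mul]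
      have hX : algebraMap L[X] E Polynomial.X ≠ 0 := by
        rw [Ne, FaithfulSMul.algebraMap_eq_zero_iff]
        exact Polynomial.X_ne_zero
      rw [memM, ← inv_smul_smul₀ hX (ι y), ← h1]
      exact W.smul_mem _ x.2
    have hxy : x = (Polynomial.X : L[X]) • (⟨y, hyM⟩ : M) := by
      ext1
      funext l
      exact hy l
    have h2 := congrArg (fun z => β.repr z i) hxy
    have h3 : β.repr x i = Polynomial.C (g i) := by
      rw [show x = ∑ j, Polynomial.C (g j) • β j from rfl, β.repr_sum_self]
    simp only [h3, map_smul, Finsupp.smul_apply, smul_eq_mul] at h2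
    simpa using congrArg (Polynomial.eval 0) h2
  let ev : (Fin n → L[X]) →+ (Fin n → L) :=
    ((Polynomial.evalRingHom (0 : L)).toAddMonoidHom).compLeft (Fin n)
  refine ⟨Submodule.span L (Set.range c), ?_, ?_⟩
  · have key : ∀ x ∈ Submodule.span L (Set.range c), ∃ y ∈ M, ∀ l, x l = (y l).eval 0 := by
      intro x hx
      obtain ⟨f, rfl⟩ := (Submodule.mem_span_range_iff_exists_fun L).1 hx
      refine ⟨∑ i, Polynomial.C (f i) • (β i : Fin n → L[X]),
        M.sum_mem fun i _ => M.smul_mem _ (β i).2, fun l => ?_⟩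
      simp [c, Polynomial.eval_finsetSum]
    intro x hx y hy
    obtain ⟨x', hx', hxx⟩ := key x hx
    obtain ⟨y', hy', hyy⟩ := key y hy
    have h1 : ∑ l, Polynomial.C (d l) * x' l * y' l = 0 := by
      apply IsFractionRing.injective L[X] E
      rw [map_sum, map_zero, ← hW _ hx' _ hy']
      refine Finset.sum_congr rfl fun l _ => ?_
      simp only [map_mul, hι, bc]
      congr 2
    have := congrArg (Polynomial.eval 0) h1
    simpa [Polynomial.eval_finsetSum, hxx, hyy] using this
  · rw [finrank_span_eq_card hli, Fintype.card_fin]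
    omega

end Lagrangian

section Quadric

theorem eval₂_formPoly {R S : Type*} [CommRing R] [CommRing S] (f : R →+* S) {n : ℕ}
    (d : Fin n → R) (y : Fin n → S) :
    MvPolynomial.eval₂ f y (formPoly d) = evalQF (bc f d) y := by
  simp only [← MvPolynomial.coe_eval₂Hom, formPoly, map_sum, evalQF, bc, map_mul, map_pow,
    MvPolynomial.eval₂Hom_C, MvPolynomial.eval₂Hom_X']

theorem evalQF_succ {R : Type*} [CommRing R] {n : ℕ} (d v : Fin (n + 1) → R) :
    evalQF d v = d 0 * v 0 ^ 2 + evalQF (Fin.tail d) (Fin.tail v) := by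
  simp [evalQF, Fin.sum_univ_succ, Fin.tail]

/-- The reflection formula: `p(u) v - 2 b(v, u) u` lies on the quadric through `v`. -/
theorem evalQF_reflect {R : Type*} [CommRing R] {n : ℕ} (d u v : Fin n → R)
    (hv : evalQF d v = 0) :
    evalQF d (evalQF d u • v - (2 * ∑ i, d i * v i * u i) • u) = 0 := by
  set b := ∑ i, d i * v i * u i with hb
  have h1 := evalQF_add d (evalQF d u • v) (-(2 * b) • u)
  have h2 : ∑ i, d i * (evalQF d u • v) i * (-(2 * b) • u) i = evalQF d u * -(2 * b) * b := by
    conv_rhs => rw [hb, Finset.mul_sum]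
    refine Finset.sum_congr rfl fun i _ => ?_
    simp only [Pi.smul_apply, smul_eq_mul, ← hb]
    ring
  rw [evalQF_smul, evalQF_smul, hv, h2, neg_smul, ← sub_eq_add_neg] at h1
  rw [h1]
  ring

/-- A class of the coordinate ring that is not a zero divisor divides a nonzero polynomial in all
variables but the first. -/
theorem exists_norm_of_mem_nonZeroDivisors {F : Type*} [Field F] {n : ℕ} {p : Fin (n + 1) → F}
    (hp : p 0 ≠ 0) {s : CoordRing p} (hs : s ∈ nonZeroDivisors (CoordRing p)) :
    ∃ (N : MvPolynomial (Fin n) F), N ≠ 0 ∧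
      s ∣ Ideal.Quotient.mk _ (MvPolynomial.rename Fin.succ N) := by
  let A := MvPolynomial (Fin n) F
  let e := MvPolynomial.finSuccEquiv F n
  let c : A := MvPolynomial.C (p 0)⁻¹ * formPoly (Fin.tail p)
  let g : A[X] := Polynomial.X ^ 2 + Polynomial.C c
  have heC : ∀ a : A, e.symm (Polynomial.C a) = MvPolynomial.rename Fin.succ a := by
    intro a
    rw [AlgEquiv.symm_apply_eq]
    have h1 : Polynomial.C =
        e.toAlgHom.toRingHom.comp (MvPolynomial.rename Fin.succ : A →ₐ[F] _).toRingHom := by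
      refine MvPolynomial.ringHom_ext (fun r => ?_) (fun i => ?_) <;>
        simp [e, MvPolynomial.finSuccEquiv_apply]
    exact RingHom.congr_fun h1 a
  have hg : g.Monic := Polynomial.monic_X_pow_add_C c two_ne_zero
  have hgdeg : g.degree = 2 := by
    simpa using Polynomial.degree_X_pow_add_C (n := 2) (by norm_num) c
  have hpg : e (formPoly p) = Polynomial.C (MvPolynomial.C (p 0)) * g := by
    have : (MvPolynomial.C (p 0) * c : A) = formPoly (Fin.tail p) := by
      rw [← mul_assoc, ← map_mul, mul_inv_cancel₀ hp, map_one, one_mul]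
    rw [mul_add, ← map_mul, this]
    simp [formPoly, e, Fin.sum_univ_succ, Fin.tail, MvPolynomial.finSuccEquiv_apply]
  let π : A[X] →+* CoordRing p :=
    (Ideal.Quotient.mk (Ideal.span {formPoly p})).comp e.symm.toAlgHom.toRingHom
  have hπ : ∀ f, π f = Ideal.Quotient.mk _ (e.symm f) := fun f => rfl
  have hπg : π g = 0 := by
    have h1 : e.symm (Polynomial.C (MvPolynomial.C (p 0)⁻¹) *
        (Polynomial.C (MvPolynomial.C (p 0)) * g)) = e.symm g := by
      rw [← mul_assoc, ← map_mul, ← map_mul, inv_mul_cancel₀ hp]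
      simp
    rw [hπ, ← h1, ← hpg, map_mul, e.symm_apply_apply, Ideal.Quotient.eq_zero_iff_mem]
    exact Ideal.mul_mem_left _ _ (Ideal.subset_span rfl)
  have hπ0 : ∀ f, π f = 0 → g ∣ f := by
    intro f hf
    rw [hπ, Ideal.Quotient.eq_zero_iff_mem, Ideal.mem_span_singleton] at hf
    have h1 := map_dvd e hf
    rw [hpg, e.apply_symm_apply] at h1
    exact (Dvd.intro_left _ rfl).trans h1
  obtain ⟨f, rfl⟩ := Ideal.Quotient.mk_surjective s
  obtain ⟨α, β, hf⟩ : ∃ α β : A, e f %ₘ g = Polynomial.C β * Polynomial.X + Polynomial.C α := by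
    have h1 : (e f %ₘ g).degree ≤ 1 := by
      have := Polynomial.degree_modByMonic_lt (e f) hg
      rw [hgdeg] at this
      exact Order.le_of_lt_succ this
    exact ⟨_, _, Polynomial.eq_X_add_C_of_degree_le_one h1⟩
  have hsf : Ideal.Quotient.mk (Ideal.span {formPoly p}) f =
      π (Polynomial.C β * Polynomial.X + Polynomial.C α) := by
    rw [← hf, ← e.symm_apply_apply f, ← hπ, AlgEquiv.apply_symm_apply]
    conv_lhs => rw [← Polynomial.modByMonic_add_div (e f) g]
    rw [map_add, map_mul, hπg, zero_mul, add_zero]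
  rw [hsf] at hs ⊢
  have hnorm : π ((Polynomial.C β * Polynomial.X + Polynomial.C α) *
      (Polynomial.C (-β) * Polynomial.X + Polynomial.C α)) =
      Ideal.Quotient.mk _ (MvPolynomial.rename Fin.succ (α ^ 2 + β ^ 2 * c)) := by
    rw [← heC, ← hπ]
    have : (Polynomial.C β * Polynomial.X + Polynomial.C α) *
      (Polynomial.C (-β) * Polynomial.X + Polynomial.C α) =
      Polynomial.C (α ^ 2 + β ^ 2 * c) - Polynomial.C (β ^ 2) * g := by
      simp only [g, map_add, map_mul, map_pow, map_neg]
      ring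
    rw [this, map_sub, map_mul, hπg, mul_zero, sub_zero]
  refine ⟨α ^ 2 + β ^ 2 * c, fun h0 => ?_, ⟨_, (hnorm.symm.trans (map_mul π _ _))⟩⟩
  rw [h0, map_zero, map_zero, map_mul] at hnorm
  have h1 := hπ0 _ ((mem_nonZeroDivisors_iff.1 hs).1 _ hnorm)
  have h3 : (Polynomial.C (-β) * Polynomial.X + Polynomial.C α) = 0 := by
    by_contra h
    refine hg.not_dvd_of_degree_lt h ?_ h1
    rw [hgdeg]
    exact Polynomial.degree_linear_le.trans_lt (by norm_num)
  have hα : α = 0 := by simpa using congrArg (fun f => Polynomial.coeff f 0) h3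
  have hβ : β = 0 := by simpa using congrArg (fun f => Polynomial.coeff f 1) h3
  subst hα hβ
  have h4 := (mem_nonZeroDivisors_iff.1 hs).1 (π 1) (by simp)
  have h5 := hπ0 1 h4
  have := Polynomial.degree_le_of_dvd h5 one_ne_zero
  rw [hgdeg, Polynomial.degree_one] at this
  exact absurd this (by norm_num)

/-- On a quadric with a rational point over an infinite field, any nonzero polynomial in all
variables but the first is nonzero at some rational point. -/
theorem exists_point_eval_ne_zero {E : Type*} [Field E] [Infinite E] (h2 : (2 : E) ≠ 0) {n : ℕ}
    {p : Fin (n + 1) → E} (hp : Nondeg p) {v : Fin (n + 1) → E} (hv : v ≠ 0)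
    (hpv : evalQF p v = 0) {N : MvPolynomial (Fin n) E} (hN : N ≠ 0) :
    ∃ y : Fin (n + 1) → E, evalQF p y = 0 ∧ MvPolynomial.eval (Fin.tail y) N ≠ 0 := by
  let P : MvPolynomial (Fin (n + 1)) E := formPoly p
  let b : MvPolynomial (Fin (n + 1)) E :=
    ∑ i, MvPolynomial.C (p i * v i) * MvPolynomial.X i
  let Y : Fin (n + 1) → MvPolynomial (Fin (n + 1)) E := fun i =>
    P * MvPolynomial.C (v i) - 2 * b * MvPolynomial.X i
  let G : MvPolynomial (Fin (n + 1)) E := MvPolynomial.aeval (Fin.tail Y) N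
  have hG : ∀ {S : Type _} [Field S] (f : E →+* S) (u : Fin (n + 1) → S),
      MvPolynomial.eval₂ f u G = MvPolynomial.eval₂ f (Fin.tail
        (evalQF (bc f p) u • bc f v - (2 * ∑ i, bc f p i * bc f v i * u i) • u)) N := by
    intro S _ f u
    have h1 : ∀ i, MvPolynomial.eval₂ f u (Y i) =
        (evalQF (bc f p) u • bc f v - (2 * ∑ i, bc f p i * bc f v i * u i) • u) i := by
      intro i
      have h2 : MvPolynomial.eval₂ f u P = evalQF (bc f p) u := eval₂_formPoly f p u
      have h3 : MvPolynomial.eval₂ f u b = ∑ i, bc f p i * bc f v i * u i := by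
        simp [b, MvPolynomial.eval₂_sum, bc]
      simp [Y, MvPolynomial.eval₂_sub, h2, h3, bc]
    have h5 : (MvPolynomial.eval₂Hom f u).comp (MvPolynomial.aeval (Fin.tail Y)).toRingHom =
        MvPolynomial.eval₂Hom f (Fin.tail
        (evalQF (bc f p) u • bc f v - (2 * ∑ i, bc f p i * bc f v i * u i) • u)) := by
      refine MvPolynomial.ringHom_ext (fun r => ?_) (fun i => ?_)
      · simp
      · simp only [RingHom.comp_apply, AlgHom.toRingHom_eq_coe, RingHom.coe_coe,
          MvPolynomial.aeval_X, MvPolynomial.eval₂Hom_X']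
        exact h1 i.succ
    exact RingHom.congr_fun h5 N
  by_contra! hcon
  have hG0 : G = 0 := by
    refine MvPolynomial.funext fun u => ?_
    have h1 := hG (RingHom.id E) u
    rw [map_zero, MvPolynomial.eval, MvPolynomial.coe_eval₂Hom, h1]
    exact hcon _ (evalQF_reflect p u v hpv)
  let ι := algebraMap E (AlgebraicClosure E)
  have hι : Function.Injective ι := ι.injective
  let l : MvPolynomial (Fin n) E :=
    ∑ i : Fin n, MvPolynomial.C (p i.succ * v i.succ) * MvPolynomial.X i
  have hl : l ≠ 0 := by
    intro hl
    have h1 : ∀ i : Fin n, v i.succ = 0 := by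
      intro i
      have h3 := congrArg (MvPolynomial.eval (Pi.single i (1 : E))) hl
      simp only [l, map_sum, map_mul, MvPolynomial.eval_C, MvPolynomial.eval_X, map_zero] at h3
      simpa [Pi.single_apply, hp i.succ] using h3
    apply hv
    have h3 : v 0 = 0 := by
      rw [evalQF_succ] at hpv
      simpa [evalQF, Fin.tail, h1, hp 0] using hpv
    ext i
    refine Fin.cases h3 h1 i
  obtain ⟨z, hz⟩ : ∃ z : Fin n → E, MvPolynomial.eval z (N * l) ≠ 0 := by
    by_contra! h
    exact mul_ne_zero hN hl (MvPolynomial.funext fun z => by rw [h z, map_zero])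
  rw [map_mul] at hz
  have hzN := left_ne_zero_of_mul hz
  have hzl : ∑ i, p i.succ * v i.succ * z i ≠ 0 := by
    have := right_ne_zero_of_mul hz
    simpa [l] using this
  obtain ⟨t, ht⟩ := IsAlgClosed.exists_pow_nat_eq
    (-ι (evalQF (Fin.tail p) z) / ι (p 0)) (n := 2) (by norm_num)
  have hp0 : ι (p 0) ≠ 0 := (map_ne_zero ι).2 (hp 0)
  have h2' : (2 : AlgebraicClosure E) ≠ 0 := by
    have := (map_ne_zero ι).2 h2
    rwa [map_ofNat] at this
  obtain ⟨t', ht', hbt⟩ : ∃ t', t' ^ 2 = -ι (evalQF (Fin.tail p) z) / ι (p 0) ∧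
      ι (p 0) * ι (v 0) * t' + ι (∑ i, p i.succ * v i.succ * z i) ≠ 0 := by
    by_contra! h
    have e1 := h t ht
    have e2 := h (-t) (by rw [neg_sq, ht])
    have e3 : 2 * ι (∑ i, p i.succ * v i.succ * z i) = 0 := by linear_combination e1 + e2
    exact hzl ((map_eq_zero ι).1 ((mul_eq_zero.1 e3).resolve_left h2'))
  let y : Fin (n + 1) → AlgebraicClosure E := Fin.cons t' (fun i => ι (z i))
  have hy : evalQF (bc ι p) y = 0 := by
    rw [evalQF_succ]
    have h1 : evalQF (Fin.tail (bc ι p)) (Fin.tail y) = ι (evalQF (Fin.tail p) z) := by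
      simp [evalQF, Fin.tail, bc, y]
    have h3 : y 0 = t' := rfl
    rw [h1, h3, ht', bc]
    field_simp
    ring
  have hb : ∑ i, bc ι p i * bc ι v i * y i =
      ι (p 0) * ι (v 0) * t' + ι (∑ i, p i.succ * v i.succ * z i) := by
    simp [Fin.sum_univ_succ, y, bc]
  obtain ⟨r, hr⟩ := IsAlgClosed.exists_pow_nat_eq
    (-(2 * ∑ i, bc ι p i * bc ι v i * y i)⁻¹) (n := 2) (by norm_num)
  have hb0 : 2 * ∑ i, bc ι p i * bc ι v i * y i ≠ 0 := mul_ne_zero h2' (hb ▸ hbt)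
  have h1 := hG ι (r • y)
  have h3 : ∑ i, bc ι p i * bc ι v i * (r • y) i = r * ∑ i, bc ι p i * bc ι v i * y i := by
    rw [Finset.mul_sum]
    exact Finset.sum_congr rfl fun i _ => by rw [Pi.smul_apply, smul_eq_mul]; ring
  have h4 : (2 * (r * ∑ i, bc ι p i * bc ι v i * y i)) * r = -1 := by
    have : (2 * (r * ∑ i, bc ι p i * bc ι v i * y i)) * r =
      r ^ 2 * (2 * ∑ i, bc ι p i * bc ι v i * y i) := by ring
    rw [this, hr, neg_mul, inv_mul_cancel₀ hb0]
  rw [h3, evalQF_smul, hy, mul_zero, zero_smul, zero_sub, smul_smul, h4, neg_smul, one_smul,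
    neg_neg, hG0, MvPolynomial.eval₂_zero] at h1
  have h5 : MvPolynomial.eval₂ ι (Fin.tail y) N = ι (MvPolynomial.eval z N) := by
    have : Fin.tail y = ι ∘ z := by
      ext i
      simp [Fin.tail, y]
    rw [this, MvPolynomial.eval, MvPolynomial.coe_eval₂Hom, MvPolynomial.eval₂_comp_left,
      RingHom.comp_id]
  rw [h5] at h1
  exact hzN ((map_eq_zero ι).1 h1.symm)

end Quadric

section Specialization

theorem bc_bc {R S T : Type*} [CommRing R] [CommRing S] [CommRing T] (g : S →+* T) (f : R →+* S)
    {n : ℕ} (d : Fin n → R) : bc g (bc f d) = bc (g.comp f) d := rfl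

theorem Nondeg.bc {F K : Type*} [Field F] [Field K] (f : F →+* K) {n : ℕ} {d : Fin n → F}
    (hd : Nondeg d) : Nondeg (bc f d) :=
  fun i => (map_ne_zero f).2 (hd i)

instance {F : Type*} [Field F] {n : ℕ} (p : Fin n → F) : Nontrivial (CoordRing p) := by
  refine Ideal.Quotient.nontrivial_iff.2 fun h => ?_
  have h1 := (Ideal.span_singleton_eq_top.1 h).map (MvPolynomial.eval₂Hom (RingHom.id F) 0)
  rw [MvPolynomial.coe_eval₂Hom, eval₂_formPoly] at h1
  simp [evalQF] at h1

/-- If `q` becomes hyperbolic over the function field of `p`, then `q` has a Lagrangian over every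
field over which `p` is isotropic. -/
theorem hasLagrangian_of_isotropic {F L : Type*} [Field F] [Field L] (h2 : (2 : F) ≠ 0)
    {n nq : ℕ} {p : Fin (n + 1) → F} (hp : Nondeg p) {q : Fin nq → F}
    (hhyp : IsHyperbolic (bc (algebraMap F (FunField p)) q)) (f : F →+* L)
    (hiso : Isotropic (bc f p)) : HasLagrangian (bc f q) := by
  have h2A : IsUnit (2 : CoordRing p) := by
    have := (isUnit_iff_ne_zero.2 h2).map (algebraMap F (CoordRing p))
    rwa [map_ofNat] at this
  have hhyp' : IsHyperbolic (bc (algebraMap (CoordRing p) (FractionRing (CoordRing p)))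
      (bc (algebraMap F (CoordRing p)) q)) := by
    rwa [bc_bc, ← IsScalarTower.algebraMap_eq]
  obtain ⟨s, hs, hψ⟩ := hhyp'.exists_nonZeroDivisor_hasLagrangian h2A
  obtain ⟨N, hN, hsN⟩ := exists_norm_of_mem_nonZeroDivisors (hp 0) hs
  let E := FractionRing L[X]
  let g : L →+* E := (algebraMap L[X] E).comp Polynomial.C
  have : Infinite E := Infinite.of_injective _ (IsFractionRing.injective L[X] E)
  have h2E : (2 : E) ≠ 0 := by
    have := (map_ne_zero (g.comp f)).2 h2
    rwa [map_ofNat] at this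
  obtain ⟨v, hv, hpv⟩ := hiso
  have hgv : g ∘ v ≠ 0 := by
    obtain ⟨i, hi⟩ := Function.ne_iff.1 hv
    exact Function.ne_iff.2 ⟨i, (map_ne_zero g).2 hi⟩
  have hpgv : evalQF (bc (g.comp f) p) (g ∘ v) = 0 := by
    rw [← map_zero g, ← hpv]
    simp [evalQF, bc]
  obtain ⟨y, hy, hNy⟩ := exists_point_eval_ne_zero h2E (hp.bc (g.comp f)) hgv hpgv
    ((map_ne_zero_iff _ (MvPolynomial.map_injective _ (g.comp f).injective)).2 hN)
  let ψ : CoordRing p →+* E := Ideal.Quotient.lift _ (MvPolynomial.eval₂Hom (g.comp f) y) <| by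
    intro r hr
    obtain ⟨t, rfl⟩ := Ideal.mem_span_singleton.1 hr
    rw [map_mul, MvPolynomial.coe_eval₂Hom, eval₂_formPoly, hy, zero_mul]
  have hψN : ψ (Ideal.Quotient.mk _ (MvPolynomial.rename Fin.succ N)) =
      MvPolynomial.eval (Fin.tail y) (MvPolynomial.map (g.comp f) N) := by
    rw [Ideal.Quotient.lift_mk, MvPolynomial.eval_map, MvPolynomial.coe_eval₂Hom,
      MvPolynomial.eval₂_rename]
    rfl
  have hψs : ψ s ≠ 0 := by
    intro h0
    have := map_dvd ψ hsN
    rw [h0, zero_dvd_iff, hψN] at this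
    exact hNy this
  have h := hψ ψ hψs
  have hψF : bc ψ (bc (algebraMap F (CoordRing p)) q) = bc g (bc f q) := by
    ext i
    exact MvPolynomial.eval₂_C (g.comp f) y (q i)
  rw [hψF] at h
  exact h.of_rationalFunctions

end Specialization

section Similarity

variable {K : Type*} [Field K] {n : ℕ}

/-- The symmetric bilinear form with diagonal Gram matrix `d`. -/
noncomputable def diagForm (d : Fin n → K) : BilinForm K (Fin n → K) :=
  Matrix.toBilin' (Matrix.diagonal d)

theorem diagForm_apply (d x y : Fin n → K) : diagForm d x y = ∑ i, d i * x i * y i := by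
  rw [diagForm, Matrix.toBilin'_apply']
  simp only [dotProduct, Matrix.mulVec_diagonal]
  exact Finset.sum_congr rfl fun i _ => by ring

theorem diagForm_symm (d x y : Fin n → K) : diagForm d x y = diagForm d y x := by
  simp only [diagForm_apply]
  exact Finset.sum_congr rfl fun i _ => by ring

theorem diagForm_self (d x : Fin n → K) : diagForm d x x = evalQF d x := by
  rw [diagForm_apply]
  exact Finset.sum_congr rfl fun i _ => by ring

theorem Nondeg.nondegenerate_diagForm {d : Fin n → K} (hd : Nondeg d) :
    (diagForm d).Nondegenerate := by
  rw [diagForm, LinearMap.BilinForm.nondegenerate_toBilin'_iff_det_ne_zero, Matrix.det_diagonal]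
  exact Finset.prod_ne_zero_iff.2 fun i _ => hd i

theorem Nondeg.isometric_smulQF {d : Fin n → K} (hd : Nondeg d) {c : K} (hc : c ≠ 0)
    (f : (Fin n → K) →ₗ[K] (Fin n → K))
    (hf : ∀ x y, diagForm d (f x) (f y) = c * diagForm d x y) : Isometric (smulQF c d) d := by
  have hinj : Function.Injective f := by
    refine (injective_iff_map_eq_zero f).2 fun x hx => ?_
    refine hd.nondegenerate_diagForm.1 x fun y => ?_
    have h := hf x y
    rw [hx, map_zero, LinearMap.zero_apply] at h
    exact (mul_eq_zero.1 h.symm).resolve_left hc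
  refine ⟨LinearEquiv.ofInjectiveEndo f hinj, fun v => ?_⟩
  rw [LinearEquiv.coe_ofInjectiveEndo, ← diagForm_self, hf, diagForm_self]
  simp only [evalQF, smulQF, Finset.mul_sum, mul_assoc]

/-- Every nonzero scalar is a similarity factor of a form with a Lagrangian. -/
theorem HasLagrangian.isometric_smulQF {d : Fin n → K} (h : HasLagrangian d) (h2 : (2 : K) ≠ 0)
    (hd : Nondeg d) {a : K} (ha : a ≠ 0) : Isometric (smulQF a d) d := by
  obtain ⟨I, hI, hdim⟩ := h
  have hI' : ∀ x ∈ I, ∀ y ∈ I, diagForm d x y = 0 := fun x hx y hy => by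
    rw [diagForm_apply, hI x hx y hy]
  have hprod : finrank K (I × I) ≤ finrank K (I.prod I) :=
    LinearMap.finrank_le_finrank_of_injective
      (f := (I.subtype.prodMap I.subtype).codRestrict (I.prod I) fun z => ⟨z.1.2, z.2.2⟩)
      fun _ _ h => (Prod.map_injective.2 ⟨I.injective_subtype, I.injective_subtype⟩)
        (congrArg Subtype.val h)
  rw [Module.finrank_prod, ← two_mul] at hprod
  obtain ⟨f, hf⟩ := exists_similitude_of_lagrangian h2 (diagForm d) hd.nondegenerate_diagForm
    (diagForm_symm d) (neg_ne_zero.2 ha) (I.prod I)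
    (fun x y hxy => ⟨I.smul_mem _ hxy.2, hxy.1⟩)
    (fun x y x' y' h h' => by rw [hI' x h.1 x' h'.1, hI' y h.2 y' h'.2, mul_zero, add_zero])
    (by rw [Module.finrank_fin_fun]; exact hdim.trans hprod) 0 1
  refine hd.isometric_smulQF ha f fun x y => ?_
  rw [hf]
  ring

/-- The linear equivalence sending a pair of vectors `(x, y)` to `x + y √Δ`. -/
def quadraticVec (Δ : K) : ((Fin n → K) × (Fin n → K)) ≃ₗ[K] (Fin n → QuadraticAlgebra K Δ 0) where
  toFun z i := ⟨z.1 i, z.2 i⟩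
  invFun w := (fun i => (w i).re, fun i => (w i).im)
  map_add' _ _ := rfl
  map_smul' _ _ := rfl
  left_inv _ := rfl
  right_inv _ := rfl

/-- Nonzero norms from a quadratic extension are similarity factors of a form that has a
Lagrangian over this extension. -/
theorem isometric_smulQF_of_hasLagrangian_quadraticAlgebra {Δ : K}
    [Fact (∀ r : K, r ^ 2 ≠ Δ + 0 * r)] {d : Fin n → K}
    (h : HasLagrangian (bc (algebraMap K (QuadraticAlgebra K Δ 0)) d)) (h2 : (2 : K) ≠ 0)
    (hΔ : Δ ≠ 0) (hd : Nondeg d) {α β : K} (hab : α ^ 2 - Δ * β ^ 2 ≠ 0) :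
    Isometric (smulQF (α ^ 2 - Δ * β ^ 2) d) d := by
  obtain ⟨I, hI, hdim⟩ := h
  let W := (I.restrictScalars K).comap (quadraticVec Δ).toLinearMap
  have hmem : ∀ x y : Fin n → K, (x, y) ∈ W ↔
    (fun i => (⟨x i, y i⟩ : QuadraticAlgebra K Δ 0)) ∈ I := fun x y => Iff.rfl
  have hj : ∀ x y, (x, y) ∈ W → (Δ • y, x) ∈ W := by
    intro x y hxy
    rw [hmem] at hxy ⊢
    convert I.smul_mem (⟨0, 1⟩ : QuadraticAlgebra K Δ 0) hxy using 1
    ext i <;> simp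
  have hW : ∀ x y x' y', (x, y) ∈ W → (x', y') ∈ W →
      diagForm d x x' + Δ * diagForm d y y' = 0 := by
    intro x y x' y' h h'
    have h1 := congrArg QuadraticAlgebra.re (hI _ ((hmem x y).1 h) _ ((hmem x' y').1 h'))
    rw [diagForm_apply, diagForm_apply, Finset.mul_sum, ← Finset.sum_add_distrib]
    have hre : ∀ g : Fin n → QuadraticAlgebra K Δ 0, (∑ i, g i).re = ∑ i, (g i).re := fun g =>
      map_sum (AddMonoidHom.mk' QuadraticAlgebra.re QuadraticAlgebra.re_add) g Finset.univ
    rw [hre] at h1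
    refine Eq.trans (Finset.sum_congr rfl fun i _ => ?_) h1
    simp [bc, QuadraticAlgebra.algebraMap_eq]
    ring
  have hWdim : finrank K (Fin n → K) ≤ finrank K W := by
    rw [Module.finrank_fin_fun]
    have h1 : finrank K W = finrank K (I.restrictScalars K) :=
      (LinearEquiv.ofSubmodule' (quadraticVec Δ) (I.restrictScalars K)).finrank_eq
    have h3 := Module.finrank_mul_finrank K (QuadraticAlgebra K Δ 0) I
    rw [QuadraticAlgebra.finrank_eq_two] at h3
    rw [h1]
    exact hdim.trans h3.le
  obtain ⟨f, hf⟩ := exists_similitude_of_lagrangian h2 (diagForm d) hd.nondegenerate_diagForm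
    (diagForm_symm d) hΔ W hj hW hWdim α β
  exact hd.isometric_smulQF hab f hf

theorem isometric_smulQF_sq (d : Fin n → K) {c : K} (hc : c ≠ 0) :
    Isometric (smulQF (c ^ 2) d) d := by
  refine ⟨LinearEquiv.smulOfNeZero K _ c hc, fun v => ?_⟩
  rw [LinearEquiv.smulOfNeZero_apply, evalQF_smul]
  simp only [evalQF, smulQF, Finset.mul_sum, mul_assoc]

/-- If `⟨1, -a⟩ ⊗ d` is isotropic, then `d x = a * d y` has a nontrivial solution. -/
theorem exists_of_isotropic_tensorQF {d : Fin n → K} {a : K}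
    (h : Isotropic (tensorQF ![1, -a] d)) :
    ∃ x y : Fin n → K, (x ≠ 0 ∨ y ≠ 0) ∧ evalQF d x = a * evalQF d y := by
  obtain ⟨w, hw, h0⟩ := h
  refine ⟨fun i => w (finProdFinEquiv (0, i)), fun i => w (finProdFinEquiv (1, i)), ?_, ?_⟩
  · by_contra! h
    apply hw
    ext j
    obtain ⟨⟨k, i⟩, rfl⟩ := finProdFinEquiv.surjective j
    fin_cases k
    · exact congrFun h.1 i
    · exact congrFun h.2 i
  · rw [evalQF, ← finProdFinEquiv.sum_comp, Fintype.sum_prod_type, Fin.sum_univ_two] at h0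
    simp only [tensorQF, Equiv.symm_apply_apply, Matrix.cons_val_zero, Matrix.cons_val_one,
      one_mul, neg_mul, mul_assoc, Finset.sum_neg_distrib] at h0
    rw [← Finset.mul_sum] at h0
    exact eq_of_sub_eq_zero (by rw [sub_eq_add_neg]; exact h0)

end Similarity

end QF

open QF in
/-- If `p` and `q` are forms over `F` (char `F ≠ 2`) and `q` becomes hyperbolic over `F(p)`,
then `H_K(p) ⊆ G_K(q)` for every field extension `K/F`. -/
theorem stmt_8 {F : Type*} [Field F] (h2 : (2 : F) ≠ 0)
    {np nq : ℕ} (p : Fin np → F) (q : Fin nq → F)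
    (hp : Nondeg p) (hq : Nondeg q) (hp0 : 0 < np) (hq0 : 0 < nq)
    (hhyp : IsHyperbolic (bc (algebraMap F (FunField p)) q)) :
    ∀ (K : Type*) [Field K] [Algebra F K],
      Hset (bc (algebraMap F K) p) ⊆ Gset (bc (algebraMap F K) q) := by
  rintro K _ _ a ⟨ha, hiso⟩
  refine ⟨ha, ?_⟩
  obtain ⟨n, rfl⟩ := Nat.exists_eq_succ_of_ne_zero hp0.ne'
  have h2K : (2 : K) ≠ 0 := by
    have := (map_ne_zero (algebraMap F K)).2 h2
    rwa [map_ofNat] at this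
  have hqK := hq.bc (algebraMap F K)
  by_cases hpK : Isotropic (bc (algebraMap F K) p)
  · exact (hasLagrangian_of_isotropic h2 hp hhyp _ hpK).isometric_smulQF h2K hqK ha
  obtain ⟨x, y, hxy, h⟩ := exists_of_isotropic_tensorQF hiso
  set P := bc (algebraMap F K) p with hP
  have haniso : ∀ z, evalQF P z = 0 → z = 0 := fun z hz => by
    by_contra hz0
    exact hpK ⟨z, hz0, hz⟩
  have hy : y ≠ 0 := by
    rintro rfl
    refine hxy.elim (fun hx => hx (haniso x ?_)) (fun hy => hy rfl)
    rw [h]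
    simp [evalQF]
  have hu : evalQF P y ≠ 0 := fun h0 => hy (haniso y h0)
  set u := evalQF P y with hu'
  set m := ∑ i, P i * x i * y i with hm
  obtain ⟨Δ, hΔdef⟩ : ∃ Δ, Δ = m ^ 2 - u * (a * u) := ⟨_, rfl⟩
  by_cases hΔ : ∃ t, t ^ 2 = Δ
  · obtain ⟨t, ht⟩ := hΔ
    have hz : evalQF P (u • x + -(m + t) • y) = 0 := by
      have h3 : ∑ i, P i * (u • x) i * (-(m + t) • y) i = u * -(m + t) * m := by
        rw [hm, Finset.mul_sum, ← hm]
        refine Finset.sum_congr rfl fun i _ => ?_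
        simp only [Pi.smul_apply, smul_eq_mul]
        ring
      rw [evalQF_add, evalQF_smul, evalQF_smul, h3, h, ← hu']
      linear_combination u * (ht.trans hΔdef)
    have hx : x = ((m + t) / u) • y := by
      have h3 : u • x = (m + t) • y := by
        have := haniso _ hz
        rwa [neg_smul, ← sub_eq_add_neg, sub_eq_zero] at this
      rw [div_eq_inv_mul, mul_smul, ← h3, smul_smul, inv_mul_cancel₀ hu, one_smul]
    have hac : a = ((m + t) / u) ^ 2 := by
      rw [hx, evalQF_smul] at h
      exact (mul_right_cancel₀ hu h).symm
    rw [hac]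
    refine isometric_smulQF_sq _ fun h0 => ha ?_
    rw [hac, h0, zero_pow two_ne_zero]
  · push Not at hΔ
    have : Fact (∀ r : K, r ^ 2 ≠ Δ + 0 * r) := ⟨fun r => by simpa using hΔ r⟩
    have hΔ0 : Δ ≠ 0 := fun h0 => hΔ 0 (by rw [h0, zero_pow two_ne_zero])
    let c : K →+* QuadraticAlgebra K Δ 0 := algebraMap K _
    let ω : QuadraticAlgebra K Δ 0 := ⟨0, 1⟩
    have hω : ω ^ 2 = c Δ := by
      rw [sq]
      ext <;> simp [ω, c, QuadraticAlgebra.algebraMap_eq]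
    have hisoL : Isotropic (bc (c.comp (algebraMap F K)) p) := by
      refine ⟨c u • (c ∘ x) + -(c m + ω) • (c ∘ y), fun h0 => hy ?_, ?_⟩
      · ext i
        have := congrArg QuadraticAlgebra.im (congrFun h0 i)
        simpa [c, ω, QuadraticAlgebra.algebraMap_eq] using this
      · have hev : ∀ z, evalQF (bc c P) (c ∘ z) = c (evalQF P z) := fun z => by
          simp [evalQF, bc]
        have h3 : ∑ i, bc c P i * (c u • (c ∘ x)) i * (-(c m + ω) • (c ∘ y)) i =
            c u * -(c m + ω) * c m := by
          rw [hm, map_sum, Finset.mul_sum, ← map_sum, ← hm]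
          refine Finset.sum_congr rfl fun i _ => ?_
          simp only [Pi.smul_apply, smul_eq_mul, Function.comp_apply, map_mul, bc]
          ring
        rw [← bc_bc, ← hP, evalQF_add, evalQF_smul, evalQF_smul, hev, hev, h3, h, ← hu']
        have h4 : c Δ = c m ^ 2 - c u * (c a * c u) := by
          rw [congrArg c hΔdef, map_sub, map_pow, map_mul, map_mul]
        rw [map_mul]
        linear_combination c u * (hω.trans h4)
    have hL := hasLagrangian_of_isotropic h2 hp hhyp _ hisoL
    rw [← bc_bc] at hL
    have hnorm : (m / u) ^ 2 - Δ * (1 / u) ^ 2 = a := by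
      simp only [hΔdef]
      field_simp
      ring
    have := isometric_smulQF_of_hasLagrangian_quadraticAlgebra hL h2K hΔ0 hqK
      (α := m / u) (β := 1 / u) (by rwa [hnorm])
    rwa [hnorm] at this
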